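/- Let e be the unique rational-valued function on integer partitions satisfying: e((n)) = n² for the one-part partition of n, and e(α) = −∑_i (n/(n−i))·e(α⁻ⁱ) for any partition α of n with more than one part, where the sum is over distinct part sizes i of α and α⁻ⁱ is α with one part of size i removed. Let P₃(k) denote the number of plane partitions of k (with P₃(0) = 1). Then for every n ≥ 1, n·∑_{d∣n} d² = ∑_α e(α)·∏_{i=1}^{n} P₃(i)^{α_i}, where α = (1^{α₁}2^{α₂}⋯n^{α_n}) runs through all partitions of n. -/

import Mathlib

/-- Every part of a partition of `n` with more than one part is strictly
smaller than `n`. -/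
theorem Nat.Partition.part_lt_of_one_lt_card {n : ℕ} (α : Nat.Partition n)
    (h : 1 < α.parts.card) {i : ℕ} (hi : i ∈ α.parts) : i < n := by
  have hc := Multiset.cons_erase hi
  have hsum := α.parts_sum
  rw [← hc, Multiset.sum_cons] at hsum
  have hcard : 0 < (α.parts.erase i).card := by
    rw [Multiset.card_pos]
    intro h0
    rw [h0] at hc
    rw [← hc] at h
    simp at h
  obtain ⟨j, hj⟩ := Multiset.card_pos_iff_exists_mem.mp hcard
  have hjpos : 0 < j := α.parts_pos (Multiset.mem_of_mem_erase hj)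
  have hjle : j ≤ (α.parts.erase i).sum :=
    Multiset.single_le_sum (fun x _ => Nat.zero_le x) j hj
  omega

/-- The partition of `n - i` obtained from a partition `α` of `n` by deleting
one part of size `i`. -/
def Nat.Partition.erasePart {n : ℕ} (α : Nat.Partition n) {i : ℕ}
    (hi : i ∈ α.parts) : Nat.Partition (n - i) where
  parts := α.parts.erase i
  parts_pos := fun hj => α.parts_pos (Multiset.mem_of_mem_erase hj)
  parts_sum := by
    have hc := congrArg Multiset.sum (Multiset.cons_erase hi)
    rw [Multiset.sum_cons] at hc
    have hsum := α.parts_sum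
    omega

/-- The defining property of the function `e` of Gulbrandsen and Shen:
`e` assigns a rational number to every partition of every positive integer,
the one-part partition `(n)` gets value `n ^ 2`, and for a partition `α` of `n`
with more than one part, `e α = -∑_i (n / (n - i)) · e (α⁻ⁱ)`, the sum running
over the distinct part sizes `i` of `α`, where `α⁻ⁱ` is `α` with one part of
size `i` deleted. -/
def IsKummerE (e : (n : ℕ+) → Nat.Partition (n : ℕ) → ℚ) : Prop :=
  (∀ n : ℕ+, e n (Nat.Partition.indiscrete (n : ℕ)) = (n : ℚ) ^ 2) ∧
  (∀ (n : ℕ+) (α : Nat.Partition (n : ℕ)) (hα : 1 < α.parts.card),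
    e n α = -∑ i ∈ α.parts.toFinset.attach,
      ((n : ℚ) / ((n : ℚ) - ((i : ℕ) : ℚ))) *
        e ⟨(n : ℕ) - (i : ℕ), by
              have := α.part_lt_of_one_lt_card hα (Multiset.mem_toFinset.mp i.2)
              omega⟩
          (α.erasePart (Multiset.mem_toFinset.mp i.2)))


/-- A plane partition: a finitely supported function `ℕ × ℕ → ℕ` that is
weakly decreasing in each of its two coordinates. -/
def IsPlanePartition (f : ℕ × ℕ →₀ ℕ) : Prop :=
  ∀ i j : ℕ, f (i + 1, j) ≤ f (i, j) ∧ f (i, j + 1) ≤ f (i, j)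

/-- `P₃ k`: the number of plane partitions of total sum `k`. -/
noncomputable def planePartitionCount (k : ℕ) : ℕ :=
  Nat.card {f : ℕ × ℕ →₀ ℕ // IsPlanePartition f ∧ (f.sum fun _ v => v) = k}

open scoped ENNReal

/-- Two finitely supported sequences interlace. -/
def Interlaces (a c : ℕ →₀ ℕ) : Prop := ∀ i, c (i + 1) ≤ a i ∧ a i ≤ c i

theorem Interlaces.le {a c : ℕ →₀ ℕ} (h : Interlaces a c) : a ≤ c := fun i => (h i).2

theorem interlaces_zero_right {a : ℕ →₀ ℕ} : Interlaces a 0 ↔ a = 0 := by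
  constructor
  · intro h
    ext i
    simpa using (h i).2
  · rintro rfl i
    simp

namespace Finsupp

/-- The sequence `a 1, a 2, …`. -/
noncomputable def natTail (a : ℕ →₀ ℕ) : ℕ →₀ ℕ :=
  a.comapDomain Nat.succ Nat.succ_injective.injOn

/-- The sequence `m, a 0, a 1, …`. -/
noncomputable def natCons (m : ℕ) (a : ℕ →₀ ℕ) : ℕ →₀ ℕ :=
  single 0 m + a.mapDomain Nat.succ

@[simp] theorem natTail_apply (a : ℕ →₀ ℕ) (i : ℕ) : a.natTail i = a (i + 1) := rfl

@[simp] theorem natCons_zero (m : ℕ) (a : ℕ →₀ ℕ) : natCons m a 0 = m := by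
  simp [natCons, mapDomain_of_notMem_range]

@[simp] theorem natCons_succ (m : ℕ) (a : ℕ →₀ ℕ) (i : ℕ) : natCons m a (i + 1) = a i := by
  have := mapDomain_apply Nat.succ_injective a i
  simp only [Nat.succ_eq_add_one] at this
  simp [natCons, this]

theorem natCons_natTail (a : ℕ →₀ ℕ) : natCons (a 0) a.natTail = a := by
  ext i
  cases i <;> simp

theorem degree_natCons (m : ℕ) (a : ℕ →₀ ℕ) : (natCons m a).degree = m + a.degree := by
  rw [natCons, map_add, degree_single]
  congr 1
  simp

theorem degree_eq_head_add (a : ℕ →₀ ℕ) : a.degree = a 0 + a.natTail.degree := by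
  conv_lhs => rw [← natCons_natTail a]
  exact degree_natCons _ _

end Finsupp

open Finsupp in
/-- The local rule of the Robinson–Schensted–Knuth correspondence. -/
noncomputable def interlacesEquiv (a b : ℕ →₀ ℕ) :
    {c // Interlaces a c ∧ Interlaces b c} ≃ {d // Interlaces d a ∧ Interlaces d b} × ℕ where
  toFun c := ⟨⟨a ⊓ b + (a ⊔ b).natTail - natTail c.1, by
    constructor <;> intro i <;> have := c.2.1 i <;> have := c.2.2 i <;>
      have := c.2.1 (i + 1) <;> have := c.2.2 (i + 1) <;> simp <;> omega⟩,
    c.1 0 - (a ⊔ b) 0⟩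
  invFun p := ⟨natCons ((a ⊔ b) 0 + p.2) (a ⊓ b + (a ⊔ b).natTail - p.1.1), by
    constructor <;> intro i <;> have := p.1.2.1 i <;> have := p.1.2.2 i <;>
      cases i with
      | zero =>
        simp only [zero_add] at *
        simp; omega
      | succ i =>
        have := p.1.2.1 i
        have := p.1.2.2 i
        simp; omega⟩
  left_inv c := by
    ext i
    cases i with
    | zero =>
      have := c.2.1 0
      have := c.2.2 0
      simp; omega
    | succ i =>
      have := c.2.1 i
      have := c.2.2 i
      have := c.2.1 (i + 1)
      have := c.2.2 (i + 1)
      simp; omega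
  right_inv p := by
    refine Prod.ext (Subtype.ext (Finsupp.ext fun i => ?_)) ?_
    · have := p.1.2.1 i
      have := p.1.2.2 i
      simp; omega
    · simp

open Finsupp in
theorem degree_interlacesEquiv_symm (a b : ℕ →₀ ℕ)
    (p : {d // Interlaces d a ∧ Interlaces d b} × ℕ) :
    ((interlacesEquiv a b).symm p).1.degree + p.1.1.degree = a.degree + b.degree + p.2 := by
  have hle : p.1.1 ≤ a ⊓ b + (a ⊔ b).natTail :=
    le_add_right (le_inf p.1.2.1.le p.1.2.2.le)
  have h1 : (a ⊓ b + (a ⊔ b).natTail - p.1.1).degree + p.1.1.degree =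
      (a ⊓ b).degree + (a ⊔ b).natTail.degree := by
    rw [← map_add, tsub_add_cancel_of_le hle, map_add]
  have h2 : (a ⊓ b).degree + (a ⊔ b).degree = a.degree + b.degree := by
    rw [← map_add, ← map_add]
    congr 1
    ext i
    simp
  have h3 := degree_eq_head_add (a ⊔ b)
  change (natCons ((a ⊔ b) 0 + p.2) (a ⊓ b + (a ⊔ b).natTail - p.1.1)).degree + _ = _
  rw [degree_natCons]
  omega

open Classical in
/-- The one-variable skew Schur function `s_{c/a}(y)`. -/
noncomputable def skewWeight (y : ℝ≥0∞) (a c : ℕ →₀ ℕ) : ℝ≥0∞ :=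
  if Interlaces a c then y ^ (c.degree - a.degree) else 0

theorem Interlaces.degree_le {a c : ℕ →₀ ℕ} (h : Interlaces a c) : a.degree ≤ c.degree :=
  Finsupp.degree_mono h.le

/-- The skew Cauchy identity in one pair of variables. -/
theorem tsum_skewWeight_mul (y : ℝ≥0∞) (a b : ℕ →₀ ℕ) :
    ∑' c, skewWeight 1 a c * skewWeight y b c =
      (1 - y)⁻¹ * ∑' d, skewWeight y d a * skewWeight 1 d b := by
  classical
  have h1 : ∑' c, skewWeight 1 a c * skewWeight y b c =
      ∑' c : {c // Interlaces a c ∧ Interlaces b c}, y ^ (c.1.degree - b.degree) := by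
    refine Eq.trans ?_ (tsum_subtype {c | Interlaces a c ∧ Interlaces b c}
      (fun c : ℕ →₀ ℕ => y ^ (c.degree - b.degree))).symm
    refine tsum_congr fun c => ?_
    by_cases h : Interlaces a c <;> by_cases h' : Interlaces b c <;>
      simp [skewWeight, Set.indicator, h, h']
  have h2 : ∑' d, skewWeight y d a * skewWeight 1 d b =
      ∑' d : {d // Interlaces d a ∧ Interlaces d b}, y ^ (a.degree - d.1.degree) := by
    refine Eq.trans ?_ (tsum_subtype {d | Interlaces d a ∧ Interlaces d b}
      (fun d : ℕ →₀ ℕ => y ^ (a.degree - d.degree))).symm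
    refine tsum_congr fun c => ?_
    by_cases h : Interlaces c a <;> by_cases h' : Interlaces c b <;>
      simp [skewWeight, Set.indicator, h, h']
  rw [h1, h2, ← (interlacesEquiv a b).symm.tsum_eq, ENNReal.tsum_prod', ← ENNReal.tsum_mul_left]
  refine tsum_congr fun d => ?_
  rw [← ENNReal.tsum_geometric, ← ENNReal.tsum_mul_right]
  refine tsum_congr fun m => ?_
  have h3 := degree_interlacesEquiv_symm a b (d, m)
  have h4 := d.2.1.degree_le
  have h5 := d.2.2.degree_le
  rw [← pow_add]
  congr 1
  dsimp only at h3
  omega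

/-- A weakly decreasing interlacing sequence of partitions, vanishing from index `n` on. -/
def IsInterlacingChain (n : ℕ) (g : ℕ → ℕ →₀ ℕ) : Prop :=
  (∀ t, Interlaces (g (t + 1)) (g t)) ∧ ∀ t, n ≤ t → g t = 0

open Classical in
/-- The generating function of the interlacing chains of length `n` starting at `l`. -/
noncomputable def chainSum (q : ℝ≥0∞) (n : ℕ) (l : ℕ →₀ ℕ) : ℝ≥0∞ :=
  ∑' g : ℕ → ℕ →₀ ℕ,
    if IsInterlacingChain n g ∧ g 0 = l then q ^ ∑ t ∈ Finset.range n, (g t).degree else 0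

theorem chainSum_zero (q : ℝ≥0∞) (l : ℕ →₀ ℕ) [Decidable (l = 0)] :
    chainSum q 0 l = if l = 0 then 1 else 0 := by
  rw [chainSum, tsum_eq_single 0]
  · have : IsInterlacingChain 0 0 := ⟨fun t i => by simp, fun t _ => rfl⟩
    by_cases h : l = 0
    · simp [this, h]
    · simp [h, Ne.symm h]
  · intro g hg
    rw [if_neg]
    rintro ⟨h, -⟩
    exact hg (funext fun t => h.2 t (Nat.zero_le t))

theorem chainSum_succ (q : ℝ≥0∞) (n : ℕ) (l : ℕ →₀ ℕ) :
    chainSum q (n + 1) l = q ^ l.degree * ∑' m, skewWeight 1 m l * chainSum q n m := by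
  classical
  let E : (ℕ → ℕ →₀ ℕ) ≃ (ℕ →₀ ℕ) × (ℕ → ℕ →₀ ℕ) :=
    { toFun := fun g => (g 0, fun t => g (t + 1))
      invFun := fun p t => Nat.casesOn t p.1 p.2
      left_inv := fun g => by funext t; cases t <;> rfl
      right_inv := fun p => rfl }
  have h1 : ∑' m, skewWeight 1 m l * chainSum q n m =
      ∑' g : ℕ → ℕ →₀ ℕ, if IsInterlacingChain n g ∧ Interlaces (g 0) l then
        q ^ ∑ t ∈ Finset.range n, (g t).degree else 0 := by
    simp only [chainSum, ← ENNReal.tsum_mul_left]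
    rw [ENNReal.tsum_comm]
    refine tsum_congr fun g => ?_
    rw [tsum_eq_single (g 0)]
    · by_cases h : IsInterlacingChain n g <;> by_cases h' : Interlaces (g 0) l <;>
        simp [skewWeight, h, h']
    · intro m hm
      simp [Ne.symm hm]
  rw [h1, ← ENNReal.tsum_mul_left, chainSum, ← E.symm.tsum_eq, ENNReal.tsum_prod',
    tsum_eq_single l]
  · refine tsum_congr fun g => ?_
    have h2 : IsInterlacingChain (n + 1) (E.symm (l, g)) ↔
        IsInterlacingChain n g ∧ Interlaces (g 0) l := by
      constructor
      · intro h
        exact ⟨⟨fun t => h.1 (t + 1), fun t ht => h.2 (t + 1) (by omega)⟩, h.1 0⟩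
      · intro h
        refine ⟨fun t => ?_, fun t ht => ?_⟩
        · cases t with
          | zero => exact h.2
          | succ t => exact h.1.1 t
        · cases t with
          | zero => omega
          | succ t => exact h.1.2 t (by omega)
    have h3 : ∑ t ∈ Finset.range (n + 1), (E.symm (l, g) t).degree =
        l.degree + ∑ t ∈ Finset.range n, (g t).degree := by
      rw [Finset.sum_range_succ', add_comm]
      rfl
    have h4 : E.symm (l, g) 0 = l := rfl
    rw [h3, pow_add]
    simp only [h2, h4, and_true]
    split_ifs <;> simp
  · intro m hm
    rw [ENNReal.tsum_eq_zero]
    intro g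
    rw [if_neg]
    rintro ⟨-, h⟩
    exact hm h

theorem pow_mul_skewWeight (q y : ℝ≥0∞) (a c : ℕ →₀ ℕ) :
    q ^ c.degree * skewWeight y a c = q ^ a.degree * skewWeight (q * y) a c := by
  rw [skewWeight, skewWeight]
  split_ifs with h
  · have h2 : q ^ c.degree = q ^ a.degree * q ^ (c.degree - a.degree) := by
      rw [← pow_add, Nat.add_sub_cancel' h.degree_le]
    rw [h2, mul_pow]
    ring
  · simp

/-- The chain generating function is an eigenvector of the operator with kernel `skewWeight`. -/
theorem tsum_skewWeight_mul_chainSum (q : ℝ≥0∞) (n : ℕ) (y : ℝ≥0∞) (b : ℕ →₀ ℕ) :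
    ∑' c, skewWeight y b c * chainSum q n c =
      (∏ i ∈ Finset.range n, (1 - q ^ (i + 1) * y)⁻¹) * chainSum q n b := by
  classical
  induction n generalizing y b with
  | zero =>
    rw [tsum_eq_single 0]
    · by_cases h : b = 0 <;> simp [chainSum_zero, skewWeight, interlaces_zero_right, h]
    · intro c hc
      simp [chainSum_zero, hc]
  | succ n ih =>
    calc ∑' c, skewWeight y b c * chainSum q (n + 1) c
        = ∑' c, ∑' m, q ^ b.degree * (chainSum q n m *
            (skewWeight 1 m c * skewWeight (q * y) b c)) := by
          refine tsum_congr fun c => ?_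
          rw [chainSum_succ, ← mul_assoc, mul_comm (skewWeight y b c), pow_mul_skewWeight,
            ← ENNReal.tsum_mul_left]
          refine tsum_congr fun m => ?_
          ring
      _ = q ^ b.degree * ∑' m, chainSum q n m *
            ∑' c, skewWeight 1 m c * skewWeight (q * y) b c := by
          rw [ENNReal.tsum_comm, ← ENNReal.tsum_mul_left]
          refine tsum_congr fun m => ?_
          rw [ENNReal.tsum_mul_left, ENNReal.tsum_mul_left]
      _ = q ^ b.degree * ((1 - q * y)⁻¹ * ∑' d, skewWeight 1 d b *
            ∑' m, skewWeight (q * y) d m * chainSum q n m) := by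
          congr 1
          simp only [tsum_skewWeight_mul, ← ENNReal.tsum_mul_left]
          rw [ENNReal.tsum_comm]
          refine tsum_congr fun d => tsum_congr fun m => ?_
          ring
      _ = _ := by
          simp only [ih]
          rw [chainSum_succ, Finset.prod_range_succ']
          have : ∀ i : ℕ, q ^ (i + 1) * (q * y) = q ^ (i + 1 + 1) * y := fun i => by ring
          simp only [this, zero_add, pow_one, ← ENNReal.tsum_mul_left]
          refine tsum_congr fun d => ?_
          ring

theorem chainSum_apply_zero (q : ℝ≥0∞) (n : ℕ) : chainSum q n 0 = 1 := by
  classical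
  induction n with
  | zero => simp [chainSum_zero]
  | succ n ih =>
    rw [chainSum_succ, tsum_eq_single 0]
    · simp [ih, skewWeight, interlaces_zero_right]
    · intro m hm
      simp [skewWeight, interlaces_zero_right, hm]

/-- The Cauchy identity. -/
theorem tsum_chainSum_mul_chainSum (q : ℝ≥0∞) (n b : ℕ) (y : ℝ≥0∞) :
    ∑' l, y ^ l.degree * (chainSum q n l * chainSum q b l) =
      ∏ j ∈ Finset.range b, ∏ i ∈ Finset.range n, (1 - q ^ (i + j + 2) * y)⁻¹ := by
  classical
  induction b generalizing y with
  | zero =>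
    rw [tsum_eq_single 0]
    · simp [chainSum_apply_zero]
    · intro l hl
      simp [chainSum_zero, hl]
  | succ b ih =>
    calc ∑' l, y ^ l.degree * (chainSum q n l * chainSum q (b + 1) l)
        = ∑' l, ∑' m, (q * y) ^ m.degree * chainSum q b m *
            (skewWeight (q * y) m l * chainSum q n l) := by
          refine tsum_congr fun l => ?_
          rw [chainSum_succ]
          have h : ∀ m, (q * y) ^ m.degree * chainSum q b m *
            (skewWeight (q * y) m l * chainSum q n l) =
              (chainSum q n l * (q * y) ^ l.degree) * (skewWeight 1 m l * chainSum q b m) := by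
            intro m
            have := pow_mul_skewWeight (q * y) 1 m l
            rw [mul_one] at this
            calc _ = ((q * y) ^ m.degree * skewWeight (q * y) m l) *
                  (chainSum q b m * chainSum q n l) := by ring
              _ = _ := by rw [← this]; ring
          simp only [h, ENNReal.tsum_mul_left]
          rw [mul_pow]
          ring
      _ = (∏ i ∈ Finset.range n, (1 - q ^ (i + 1) * (q * y))⁻¹) *
            ∑' m, (q * y) ^ m.degree * (chainSum q n m * chainSum q b m) := by
          rw [ENNReal.tsum_comm, ← ENNReal.tsum_mul_left]
          refine tsum_congr fun m => ?_
          rw [ENNReal.tsum_mul_left, tsum_skewWeight_mul_chainSum]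
          ring
      _ = _ := by
          rw [ih, Finset.prod_range_succ', mul_comm]
          congr 1
          · refine Finset.prod_congr rfl fun j _ => Finset.prod_congr rfl fun i _ => ?_
            congr 2
            ring
          · refine Finset.prod_congr rfl fun i _ => ?_
            congr 2
            ring

theorem IsInterlacingChain.apply_eq_zero {n : ℕ} {g : ℕ → ℕ →₀ ℕ} (hg : IsInterlacingChain n g)
    {s t : ℕ} (h : n ≤ s + t) : g t s = 0 := by
  induction s generalizing t with
  | zero => simp [hg.2 t (by omega)]
  | succ s ih =>
    have h1 := (hg.1 t s).1
    have h2 := ih (t := t + 1) (by omega)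
    omega

/-- A plane partition whose support lies in the square of side `n`. -/
def IsSquarePlanePartition (n : ℕ) (f : ℕ × ℕ →₀ ℕ) : Prop :=
  IsPlanePartition f ∧ ∀ i j, n ≤ i ∨ n ≤ j → f (i, j) = 0

/-- The diagonals of a function, on and above the main diagonal. -/
noncomputable def Finsupp.upperDiagonal (f : ℕ × ℕ →₀ ℕ) (t : ℕ) : ℕ →₀ ℕ :=
  f.comapDomain (fun s => (s, s + t)) fun _ _ _ _ h => (Prod.ext_iff.mp h).1

/-- The diagonals of a function, on and below the main diagonal. -/
noncomputable def Finsupp.lowerDiagonal (f : ℕ × ℕ →₀ ℕ) (t : ℕ) : ℕ →₀ ℕ :=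
  f.comapDomain (fun s => (s + t, s)) fun _ _ _ _ h => (Prod.ext_iff.mp h).2

@[simp] theorem Finsupp.upperDiagonal_apply (f : ℕ × ℕ →₀ ℕ) (t s : ℕ) :
    f.upperDiagonal t s = f (s, s + t) := rfl

@[simp] theorem Finsupp.lowerDiagonal_apply (f : ℕ × ℕ →₀ ℕ) (t s : ℕ) :
    f.lowerDiagonal t s = f (s + t, s) := rfl

theorem IsSquarePlanePartition.upperDiagonal {n : ℕ} {f : ℕ × ℕ →₀ ℕ}
    (hf : IsSquarePlanePartition n f) : IsInterlacingChain n f.upperDiagonal := by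
  refine ⟨fun t s => ⟨?_, ?_⟩, fun t ht => ?_⟩
  · have := (hf.1 s (s + 1 + t)).1
    simpa [add_assoc, add_comm 1 t] using this
  · exact (hf.1 s (s + t)).2
  · ext s
    exact hf.2 _ _ (Or.inr (by omega))

theorem IsSquarePlanePartition.lowerDiagonal {n : ℕ} {f : ℕ × ℕ →₀ ℕ}
    (hf : IsSquarePlanePartition n f) : IsInterlacingChain n f.lowerDiagonal := by
  refine ⟨fun t s => ⟨?_, ?_⟩, fun t ht => ?_⟩
  · have := (hf.1 (s + 1 + t) s).2
    simpa [add_assoc, add_comm 1 t] using this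
  · exact (hf.1 (s + t) s).1
  · ext s
    exact hf.2 _ _ (Or.inl (by omega))

/-- The function with prescribed diagonals. -/
noncomputable def ofDiagonals (n : ℕ) (g h : ℕ → ℕ →₀ ℕ) (hg : IsInterlacingChain n g)
    (hh : IsInterlacingChain n h) : ℕ × ℕ →₀ ℕ :=
  Finsupp.onFinset (Finset.range n ×ˢ Finset.range n)
    (fun x => if x.1 ≤ x.2 then g (x.2 - x.1) x.1 else h (x.1 - x.2) x.2) <| by
      intro x hx
      contrapose! hx
      rw [Finset.mem_product, Finset.mem_range, Finset.mem_range] at hx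
      split_ifs with hle
      · exact hg.apply_eq_zero (by omega)
      · exact hh.apply_eq_zero (by omega)

theorem ofDiagonals_apply_add_right {n : ℕ} {g h : ℕ → ℕ →₀ ℕ} (hg : IsInterlacingChain n g)
    (hh : IsInterlacingChain n h) (s t : ℕ) : ofDiagonals n g h hg hh (s, s + t) = g t s := by
  simp [ofDiagonals]

theorem ofDiagonals_apply_add_left {n : ℕ} {g h : ℕ → ℕ →₀ ℕ} (hg : IsInterlacingChain n g)
    (hh : IsInterlacingChain n h) (h0 : g 0 = h 0) (s t : ℕ) :
    ofDiagonals n g h hg hh (s + t, s) = h t s := by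
  cases t <;> simp [ofDiagonals, h0]

theorem isSquarePlanePartition_ofDiagonals {n : ℕ} {g h : ℕ → ℕ →₀ ℕ}
    (hg : IsInterlacingChain n g) (hh : IsInterlacingChain n h) (h0 : g 0 = h 0) :
    IsSquarePlanePartition n (ofDiagonals n g h hg hh) := by
  have hr := ofDiagonals_apply_add_right hg hh
  have hl := ofDiagonals_apply_add_left hg hh h0
  refine ⟨fun i j => ?_, fun i j hij => ?_⟩
  · rcases lt_trichotomy i j with hlt | rfl | hlt
    · obtain ⟨t, rfl⟩ := Nat.exists_eq_add_of_lt hlt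
      have h1 := hr (i + 1) t
      rw [show i + 1 + t = i + t + 1 by omega] at h1
      have h2 : _ = g (t + 1) i := hr i (t + 1)
      have h3 : _ = g (t + 2) i := hr i (t + 2)
      rw [← add_assoc] at h2 h3
      exact ⟨h1.trans_le ((hg.1 t i).1.trans h2.ge), h3.trans_le ((hg.1 (t + 1) i).2.trans h2.ge)⟩
    · have h1 : ofDiagonals n g h hg hh (i, i) = _ := hr i 0
      rw [hl i 1, hr i 1, h1]
      exact ⟨by rw [h0]; exact (hh.1 0 i).2, (hg.1 0 i).2⟩
    · obtain ⟨t, rfl⟩ := Nat.exists_eq_add_of_lt hlt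
      have h1 := hl (j + 1) t
      rw [show j + 1 + t = j + t + 1 by omega] at h1
      have h2 : _ = h (t + 1) j := hl j (t + 1)
      have h3 : _ = h (t + 2) j := hl j (t + 2)
      rw [← add_assoc] at h2 h3
      exact ⟨h3.trans_le ((hh.1 (t + 1) j).2.trans h2.ge), h1.trans_le ((hh.1 t j).1.trans h2.ge)⟩
  · rcases le_total i j with hle | hle
    · obtain ⟨t, rfl⟩ := Nat.exists_eq_add_of_le hle
      rw [hr]
      exact hg.apply_eq_zero (by omega)
    · obtain ⟨t, rfl⟩ := Nat.exists_eq_add_of_le hle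
      rw [hl]
      exact hh.apply_eq_zero (by omega)

/-- A plane partition in a square amounts to two interlacing chains with a common start. -/
noncomputable def squarePlanePartitionEquiv (n : ℕ) :
    {f // IsSquarePlanePartition n f} ≃
      {p : (ℕ → ℕ →₀ ℕ) × (ℕ → ℕ →₀ ℕ) //
        IsInterlacingChain n p.1 ∧ IsInterlacingChain n p.2 ∧ p.1 0 = p.2 0} where
  toFun f := ⟨(f.1.upperDiagonal, f.1.lowerDiagonal), f.2.upperDiagonal, f.2.lowerDiagonal, rfl⟩
  invFun p := ⟨ofDiagonals n p.1.1 p.1.2 p.2.1 p.2.2.1,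
    isSquarePlanePartition_ofDiagonals p.2.1 p.2.2.1 p.2.2.2⟩
  left_inv f := by
    refine Subtype.ext (Finsupp.ext fun ⟨i, j⟩ => ?_)
    rcases le_total i j with hle | hle
    · obtain ⟨t, rfl⟩ := Nat.exists_eq_add_of_le hle
      exact ofDiagonals_apply_add_right f.2.upperDiagonal f.2.lowerDiagonal i t
    · obtain ⟨t, rfl⟩ := Nat.exists_eq_add_of_le hle
      exact ofDiagonals_apply_add_left f.2.upperDiagonal f.2.lowerDiagonal rfl j t
  right_inv p := by
    refine Subtype.ext (Prod.ext ?_ ?_)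
    · funext t
      ext s
      exact ofDiagonals_apply_add_right p.2.1 p.2.2.1 s t
    · funext t
      ext s
      exact ofDiagonals_apply_add_left p.2.1 p.2.2.1 p.2.2.2 s t

theorem Finsupp.degree_eq_sum_of_support_subset {σ : Type*} (f : σ →₀ ℕ) (s : Finset σ)
    (h : ∀ x ∉ s, f x = 0) : f.degree = ∑ x ∈ s, f x := by
  rw [Finsupp.degree_apply]
  refine Finset.sum_subset (fun x hx => ?_) fun x _ hx => by simpa using hx
  by_contra hxs
  exact (Finsupp.mem_support_iff.mp hx) (h x hxs)

theorem sum_range_ite_le_eq_sum_range_add {n : ℕ} {F : ℕ → ℕ} (hF : ∀ j, n ≤ j → F j = 0)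
    (s : ℕ) :
    ∑ j ∈ Finset.range n, (if s ≤ j then F j else 0) = ∑ t ∈ Finset.range n, F (s + t) := by
  have h := Finset.sum_Ico_eq_sum_range F s (s + n)
  rw [Nat.add_sub_cancel_left] at h
  rw [← h, ← Finset.sum_filter]
  refine Finset.sum_subset (fun j hj => ?_) fun j hj hj' => hF j ?_
  · simp at hj ⊢
    omega
  · simp at hj hj'
    omega

theorem IsSquarePlanePartition.degree_add_degree {n : ℕ} {f : ℕ × ℕ →₀ ℕ}
    (hf : IsSquarePlanePartition n f) :
    f.degree + (f.upperDiagonal 0).degree =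
      ∑ t ∈ Finset.range n, (f.upperDiagonal t).degree +
        ∑ t ∈ Finset.range n, (f.lowerDiagonal t).degree := by
  have hu (t : ℕ) : (f.upperDiagonal t).degree = ∑ s ∈ Finset.range n, f (s, s + t) :=
    Finsupp.degree_eq_sum_of_support_subset _ _ fun s hs => hf.2 _ _ (Or.inl (by simpa using hs))
  have hl (t : ℕ) : (f.lowerDiagonal t).degree = ∑ s ∈ Finset.range n, f (s + t, s) :=
    Finsupp.degree_eq_sum_of_support_subset _ _ fun s hs => hf.2 _ _ (Or.inr (by simpa using hs))
  have hd : f.degree = ∑ i ∈ Finset.range n, ∑ j ∈ Finset.range n, f (i, j) := by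
    rw [← Finset.sum_product']
    refine Finsupp.degree_eq_sum_of_support_subset _ _ fun x hx => hf.2 x.1 x.2 ?_
    rw [Finset.mem_product, Finset.mem_range, Finset.mem_range] at hx
    omega
  have h0 : (f.upperDiagonal 0).degree =
      ∑ i ∈ Finset.range n, ∑ j ∈ Finset.range n, if i = j then f (i, j) else 0 := by
    rw [hu]
    refine Finset.sum_congr rfl fun i hi => ?_
    rw [Finset.sum_ite_eq, if_pos hi, add_zero]
  have h1 : ∑ t ∈ Finset.range n, (f.upperDiagonal t).degree =
      ∑ i ∈ Finset.range n, ∑ j ∈ Finset.range n, if i ≤ j then f (i, j) else 0 := by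
    simp only [hu]
    rw [Finset.sum_comm]
    exact Finset.sum_congr rfl fun i _ => (sum_range_ite_le_eq_sum_range_add
      (F := fun j => f (i, j)) (fun j hj => hf.2 _ _ (Or.inr hj)) i).symm
  have h2 : ∑ t ∈ Finset.range n, (f.lowerDiagonal t).degree =
      ∑ i ∈ Finset.range n, ∑ j ∈ Finset.range n, if j ≤ i then f (i, j) else 0 := by
    simp only [hl]
    rw [Finset.sum_comm, Finset.sum_comm (s := Finset.range n) (t := Finset.range n)
      (f := fun i j => if j ≤ i then f (i, j) else 0)]
    exact Finset.sum_congr rfl fun j _ => (sum_range_ite_le_eq_sum_range_add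
      (F := fun i => f (i, j)) (fun i hi => hf.2 _ _ (Or.inl hi)) j).symm
  rw [hd, h0, h1, h2]
  simp only [← Finset.sum_add_distrib]
  refine Finset.sum_congr rfl fun i _ => Finset.sum_congr rfl fun j _ => ?_
  split_ifs <;> omega

/-- MacMahon's formula for plane partitions in a square, evaluated at an extended real. -/
theorem tsum_squarePlanePartition (n : ℕ) {q : ℝ≥0∞} (hq : q ≠ 0) (hq' : q ≠ ∞) :
    ∑' f : {f // IsSquarePlanePartition n f}, q ^ f.1.degree =
      ∏ j ∈ Finset.range n, ∏ i ∈ Finset.range n, (1 - q ^ (i + j + 1))⁻¹ := by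
  classical
  have hqq : q * q⁻¹ = 1 := ENNReal.mul_inv_cancel hq hq'
  have h1 := tsum_chainSum_mul_chainSum q n n q⁻¹
  have h2 (i j : ℕ) : q ^ (i + j + 2) * q⁻¹ = q ^ (i + j + 1) := by
    rw [pow_succ, mul_assoc, hqq, mul_one]
  simp only [h2] at h1
  rw [← h1, ← (squarePlanePartitionEquiv n).symm.tsum_eq]
  have h3 : ∀ p : {p : (ℕ → ℕ →₀ ℕ) × (ℕ → ℕ →₀ ℕ) //
        IsInterlacingChain n p.1 ∧ IsInterlacingChain n p.2 ∧ p.1 0 = p.2 0},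
      q ^ ((squarePlanePartitionEquiv n).symm p).1.degree =
        q⁻¹ ^ (p.1.1 0).degree * (q ^ (∑ t ∈ Finset.range n, (p.1.1 t).degree) *
          q ^ (∑ t ∈ Finset.range n, (p.1.2 t).degree)) := by
    intro p
    have h4 := ((squarePlanePartitionEquiv n).symm p).2.degree_add_degree
    have h5 : ((squarePlanePartitionEquiv n).symm p).1.upperDiagonal = p.1.1 :=
      congrArg (fun x => x.1.1) ((squarePlanePartitionEquiv n).apply_symm_apply p)
    have h6 : ((squarePlanePartitionEquiv n).symm p).1.lowerDiagonal = p.1.2 :=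
      congrArg (fun x => x.1.2) ((squarePlanePartitionEquiv n).apply_symm_apply p)
    rw [h5, h6] at h4
    rw [← pow_add, ← h4, pow_add, mul_comm, mul_assoc, ← mul_pow, hqq, one_pow, mul_one]
  simp only [h3]
  refine (tsum_subtype {p : (ℕ → ℕ →₀ ℕ) × (ℕ → ℕ →₀ ℕ) |
        IsInterlacingChain n p.1 ∧ IsInterlacingChain n p.2 ∧ p.1 0 = p.2 0}
      (fun p => q⁻¹ ^ (p.1 0).degree * (q ^ (∑ t ∈ Finset.range n, (p.1 t).degree) *
          q ^ (∑ t ∈ Finset.range n, (p.2 t).degree)))).trans ?_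
  have h7 (l : ℕ →₀ ℕ) : q⁻¹ ^ l.degree * (chainSum q n l * chainSum q n l) =
      ∑' g, ∑' h, q⁻¹ ^ l.degree *
        ((if IsInterlacingChain n g ∧ g 0 = l then
          q ^ ∑ t ∈ Finset.range n, (g t).degree else 0) *
        (if IsInterlacingChain n h ∧ h 0 = l then
          q ^ ∑ t ∈ Finset.range n, (h t).degree else 0)) := by
    simp only [ENNReal.tsum_mul_left, ENNReal.tsum_mul_right, chainSum]
  simp only [h7]
  rw [ENNReal.tsum_prod']
  conv_rhs => rw [ENNReal.tsum_comm]
  refine tsum_congr fun g => ?_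
  conv_rhs => rw [ENNReal.tsum_comm]
  refine tsum_congr fun h => Eq.trans ?_ (tsum_eq_single (g 0) fun l hl => ?_).symm
  · by_cases h0 : g 0 = h 0
    · by_cases hg : IsInterlacingChain n g <;> by_cases hh : IsInterlacingChain n h <;>
        simp [Set.indicator, hg, hh, h0]
    · simp [Set.indicator, h0, Ne.symm h0]
  · simp [hl.symm]

namespace PowerSeries

/-- The value of a power series with natural number coefficients at an extended real. -/
noncomputable def ennrealEval (q : ℝ≥0∞) (φ : ℕ⟦X⟧) : ℝ≥0∞ :=
  ∑' n, ((coeff n φ : ℕ) : ℝ≥0∞) * q ^ n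

theorem ennrealEval_one (q : ℝ≥0∞) : ennrealEval q 1 = 1 := by
  rw [ennrealEval, tsum_eq_single 0]
  · simp
  · intro n hn
    simp [coeff_one, hn]

theorem ennrealEval_mul (q : ℝ≥0∞) (φ ψ : ℕ⟦X⟧) :
    ennrealEval q (φ * ψ) = ennrealEval q φ * ennrealEval q ψ := by
  have h : ennrealEval q φ * ennrealEval q ψ =
      ∑' p : ℕ × ℕ,
        ((coeff p.1 φ : ℕ) : ℝ≥0∞) * q ^ p.1 * (((coeff p.2 ψ : ℕ) : ℝ≥0∞) * q ^ p.2) := by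
    rw [ENNReal.tsum_prod']
    simp only [ENNReal.tsum_mul_left, ENNReal.tsum_mul_right, ennrealEval]
  rw [h, ← Finset.HasAntidiagonal.sigmaAntidiagonalEquivProd.tsum_eq, ENNReal.tsum_sigma',
    ennrealEval]
  refine tsum_congr fun n => ?_
  rw [coeff_mul, tsum_fintype, Nat.cast_sum, Finset.sum_mul]
  refine Eq.trans ?_ (Finset.sum_coe_sort (Finset.HasAntidiagonal.antidiagonal n) fun p =>
    ((coeff p.1 φ : ℕ) : ℝ≥0∞) * q ^ p.1 * (((coeff p.2 ψ : ℕ) : ℝ≥0∞) * q ^ p.2)).symm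
  refine Finset.sum_congr rfl fun p hp => ?_
  rw [← Finset.HasAntidiagonal.mem_antidiagonal.mp hp, pow_add]
  push_cast
  ring

theorem ennrealEval_prod {ι : Type*} (q : ℝ≥0∞) (s : Finset ι) (φ : ι → ℕ⟦X⟧) :
    ennrealEval q (∏ i ∈ s, φ i) = ∏ i ∈ s, ennrealEval q (φ i) :=
  map_prod (⟨⟨ennrealEval q, ennrealEval_one q⟩, ennrealEval_mul q⟩ : ℕ⟦X⟧ →* ℝ≥0∞) φ s

/-- The geometric series `1 + X ^ d + X ^ (2 * d) + ⋯`. -/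
def geomSeries (d : ℕ) : ℕ⟦X⟧ := mk fun n => if d ∣ n then 1 else 0

theorem ennrealEval_geomSeries (q : ℝ≥0∞) {d : ℕ} (hd : 0 < d) :
    ennrealEval q (geomSeries d) = (1 - q ^ d)⁻¹ := by
  rw [← ENNReal.tsum_geometric, ennrealEval]
  have hinj : Function.Injective fun k : ℕ => d * k := fun a b h => Nat.eq_of_mul_eq_mul_left hd h
  rw [← hinj.tsum_eq]
  · refine tsum_congr fun k => ?_
    simp [geomSeries, pow_mul]
  · intro n hn
    by_contra h
    refine hn ?_
    have : ¬ d ∣ n := fun ⟨k, hk⟩ => h ⟨k, hk.symm⟩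
    simp [geomSeries, this]

theorem ennrealEval_eq_add (q : ℝ≥0∞) (φ : ℕ⟦X⟧) :
    ennrealEval q φ =
      ((coeff 0 φ : ℕ) : ℝ≥0∞) + q * ennrealEval q (mk fun n => coeff (n + 1) φ) := by
  rw [ennrealEval, tsum_eq_zero_add' ENNReal.summable, ennrealEval, ← ENNReal.tsum_mul_left]
  simp only [pow_zero, mul_one, coeff_mk]
  congr 1
  refine tsum_congr fun n => ?_
  ring

theorem ennrealEval_mono {p q : ℝ≥0∞} (h : p ≤ q) (φ : ℕ⟦X⟧) :
    ennrealEval p φ ≤ ennrealEval q φ :=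
  ENNReal.tsum_le_tsum fun _ => by gcongr

theorem coeff_zero_le_of_ennrealEval_le {r : ℝ≥0∞} (hr : r ≠ 0) {φ ψ : ℕ⟦X⟧}
    (hψ : ennrealEval r ψ ≠ ∞)
    (h : ∀ q, q ≠ 0 → q ≤ r → ennrealEval q φ ≤ ennrealEval q ψ) :
    coeff 0 φ ≤ coeff 0 ψ := by
  by_contra! hlt
  set R := ennrealEval r (mk fun n => coeff (n + 1) ψ) with hR
  have hRtop : R ≠ ∞ := by
    intro htop
    rw [ennrealEval_eq_add, ← hR, htop, ENNReal.mul_top hr] at hψ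
    simp at hψ
  have key : ∀ q, q ≠ 0 → q ≤ r → 1 ≤ q * R := by
    intro q hq hqr
    have h1 := h q hq hqr
    rw [ennrealEval_eq_add q ψ, ennrealEval_eq_add q φ] at h1
    have h2 : ((coeff 0 ψ : ℕ) : ℝ≥0∞) + 1 ≤ ((coeff 0 φ : ℕ) : ℝ≥0∞) := by exact_mod_cast hlt
    have h3 : ((coeff 0 ψ : ℕ) : ℝ≥0∞) + 1 ≤ ((coeff 0 ψ : ℕ) : ℝ≥0∞) + q * R :=
      (h2.trans le_self_add).trans (h1.trans (by gcongr; exact ennrealEval_mono hqr _))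
    exact (ENNReal.add_le_add_iff_left (ENNReal.natCast_ne_top _)).mp h3
  have hR1 : R + 1 ≠ ∞ := by simpa using hRtop
  have h4 := key (min r (R + 1)⁻¹) (by simp [hr, hRtop]) (min_le_left _ _)
  have h5 : min r (R + 1)⁻¹ * R ≤ (R + 1)⁻¹ * R := by gcongr; exact min_le_right _ _
  have h6 : (R + 1)⁻¹ * R < (R + 1)⁻¹ * (R + 1) :=
    ENNReal.mul_lt_mul_right (ENNReal.inv_ne_zero.mpr hR1) (by simp)
      (ENNReal.lt_add_right hRtop one_ne_zero)
  rw [ENNReal.inv_mul_cancel (by simp) hR1] at h6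
  exact absurd (h4.trans h5) (not_le.mpr h6)

/-- A power series with natural number coefficients is determined by its values at small
arguments. -/
theorem ext_of_ennrealEval {r : ℝ≥0∞} (hr : r ≠ 0) (hr' : r ≠ ∞) {φ ψ : ℕ⟦X⟧}
    (hψ : ennrealEval r ψ ≠ ∞)
    (h : ∀ q, q ≠ 0 → q ≤ r → ennrealEval q φ = ennrealEval q ψ) : φ = ψ := by
  ext n
  induction n generalizing φ ψ with
  | zero =>
    have hφ : ennrealEval r φ ≠ ∞ := by rwa [h r hr le_rfl]
    exact le_antisymm (coeff_zero_le_of_ennrealEval_le hr hψ fun q hq hqr => (h q hq hqr).le)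
      (coeff_zero_le_of_ennrealEval_le hr hφ fun q hq hqr => (h q hq hqr).ge)
  | succ n ih =>
    have hφ : ennrealEval r φ ≠ ∞ := by rwa [h r hr le_rfl]
    have h0 : coeff 0 φ = coeff 0 ψ :=
      le_antisymm (coeff_zero_le_of_ennrealEval_le hr hψ fun q hq hqr => (h q hq hqr).le)
        (coeff_zero_le_of_ennrealEval_le hr hφ fun q hq hqr => (h q hq hqr).ge)
    have := @ih (mk fun n => coeff (n + 1) φ) (mk fun n => coeff (n + 1) ψ) ?_ ?_
    · simpa using this
    · intro htop
      rw [ennrealEval_eq_add, htop, ENNReal.mul_top hr] at hψ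
      simp at hψ
    · intro q hq hqr
      have h1 := h q hq hqr
      rw [ennrealEval_eq_add q ψ, ennrealEval_eq_add q φ, h0,
        ENNReal.add_right_inj (ENNReal.natCast_ne_top _)] at h1
      exact (ENNReal.mul_right_inj hq (ne_top_of_le_ne_top hr' hqr)).mp h1

theorem tsum_pow_eq_ennrealEval {T : Type*} (w : T → ℕ) (hw : ∀ n, Finite {t // w t = n})
    (q : ℝ≥0∞) :
    ∑' t, q ^ w t = ennrealEval q (mk fun n => Nat.card {t // w t = n}) := by
  rw [← (Equiv.sigmaFiberEquiv w).tsum_eq, ENNReal.tsum_sigma', ennrealEval]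
  refine tsum_congr fun n => ?_
  have := hw n
  have h : ∀ t : {t // w t = n}, q ^ w (Equiv.sigmaFiberEquiv w ⟨n, t⟩) = q ^ n := fun t => by
    rw [show w (Equiv.sigmaFiberEquiv w ⟨n, t⟩) = n from t.2]
  simp only [h]
  have := Fintype.ofFinite {t // w t = n}
  rw [tsum_fintype, Finset.sum_const, Finset.card_univ, nsmul_eq_mul, coeff_mk,
    Nat.card_eq_fintype_card]

end PowerSeries

theorem finite_isSquarePlanePartition_degree_eq (n k : ℕ) :
    Finite {f : {f // IsSquarePlanePartition n f} // f.1.degree = k} := by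
  let s := Finset.range n ×ˢ Finset.range n
  have hs (f : {f : {f // IsSquarePlanePartition n f} // f.1.degree = k}) :
      f.1.1 ∈ Finset.finsuppAntidiag s k := by
    have h0 : ∀ x ∉ s, f.1.1 x = 0 := fun x hx => f.1.2.2 x.1 x.2 <| by
      rw [Finset.mem_product, Finset.mem_range, Finset.mem_range] at hx
      omega
    rw [Finset.mem_finsuppAntidiag]
    refine ⟨?_, fun x hx => ?_⟩
    · exact (Finsupp.degree_eq_sum_of_support_subset _ s h0).symm.trans f.2
    · by_contra hxs
      exact (Finsupp.mem_support_iff.mp hx) (h0 x hxs)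
  exact Finite.of_injective (fun f => (⟨f.1.1, hs f⟩ : Finset.finsuppAntidiag s k))
    fun f g h => Subtype.ext (Subtype.ext (Subtype.mk.inj h))

open PowerSeries in
/-- MacMahon's formula for plane partitions in a square. -/
theorem mk_card_isSquarePlanePartition (n : ℕ) :
    (mk fun k => Nat.card {f : {f // IsSquarePlanePartition n f} // f.1.degree = k}) =
      ∏ x ∈ Finset.range n ×ˢ Finset.range n, geomSeries (x.1 + x.2 + 1) := by
  have heval (q : ℝ≥0∞) :
      ennrealEval q (∏ x ∈ Finset.range n ×ˢ Finset.range n, geomSeries (x.1 + x.2 + 1)) =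
        ∏ j ∈ Finset.range n, ∏ i ∈ Finset.range n, (1 - q ^ (i + j + 1))⁻¹ := by
    rw [ennrealEval_prod, Finset.prod_product_right]
    exact Finset.prod_congr rfl fun j _ => Finset.prod_congr rfl fun i _ =>
      ennrealEval_geomSeries q (Nat.succ_pos _)
  refine ext_of_ennrealEval (r := 2⁻¹) (by simp) (by simp) ?_ fun q hq hq2 => ?_
  · rw [heval]
    refine ENNReal.prod_ne_top fun j _ => ENNReal.prod_ne_top fun i _ => ?_
    refine ENNReal.inv_ne_top.mpr (tsub_pos_of_lt ?_).ne'
    exact pow_lt_one₀ zero_le (by simp) (Nat.succ_ne_zero _)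
  · rw [heval, ← tsum_squarePlanePartition n hq (ne_top_of_le_ne_top (by simp) hq2),
      tsum_pow_eq_ennrealEval _ (finite_isSquarePlanePartition_degree_eq n)]

theorem IsPlanePartition.antitone_left {f : ℕ × ℕ →₀ ℕ} (hf : IsPlanePartition f) (j : ℕ) :
    Antitone fun i => f (i, j) :=
  antitone_nat_of_succ_le fun i => (hf i j).1

theorem IsPlanePartition.antitone_right {f : ℕ × ℕ →₀ ℕ} (hf : IsPlanePartition f) (i : ℕ) :
    Antitone fun j => f (i, j) :=
  antitone_nat_of_succ_le fun j => (hf i j).2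

theorem Finsupp.card_le_degree {σ : Type*} (f : σ →₀ ℕ) (s : Finset σ) (h : ∀ x ∈ s, f x ≠ 0) :
    s.card ≤ f.degree := by
  rw [Finsupp.degree_apply, Finset.card_eq_sum_ones]
  exact (Finset.sum_le_sum fun x hx => Nat.one_le_iff_ne_zero.mpr (h x hx)).trans
    (Finset.sum_le_sum_of_subset fun x hx => Finsupp.mem_support_iff.mpr (h x hx))

theorem IsPlanePartition.isSquarePlanePartition {f : ℕ × ℕ →₀ ℕ} (hf : IsPlanePartition f) {n : ℕ}
    (hn : f.degree ≤ n) : IsSquarePlanePartition n f := by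
  refine ⟨hf, fun i j hij => ?_⟩
  by_contra h
  rcases hij with hi | hj
  · have := f.card_le_degree
      ((Finset.range (i + 1)).map ⟨fun a => (a, j), fun a b h => by simpa using h⟩) ?_
    · simp at this
      omega
    · intro x hx
      simp only [Finset.mem_map, Finset.mem_range] at hx
      obtain ⟨a, ha, rfl⟩ := hx
      have := hf.antitone_left j (Nat.lt_succ_iff.mp ha)
      dsimp only at this
      change f (a, j) ≠ 0
      omega
  · have := f.card_le_degree
      ((Finset.range (j + 1)).map ⟨fun a => (i, a), fun a b h => by simpa using h⟩) ?_
    · simp at this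
      omega
    · intro x hx
      simp only [Finset.mem_map, Finset.mem_range] at hx
      obtain ⟨a, ha, rfl⟩ := hx
      have := hf.antitone_right i (Nat.lt_succ_iff.mp ha)
      dsimp only at this
      change f (i, a) ≠ 0
      omega

open PowerSeries in
theorem planePartitionCount_eq_coeff {n k : ℕ} (hk : k ≤ n) :
    planePartitionCount k =
      coeff k (∏ x ∈ Finset.range n ×ˢ Finset.range n, geomSeries (x.1 + x.2 + 1)) := by
  rw [← mk_card_isSquarePlanePartition, coeff_mk]
  exact Nat.card_congr
    { toFun := fun f => ⟨⟨f.1, f.2.1.isSquarePlanePartition (f.2.2.trans_le hk)⟩, f.2.2⟩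
      invFun := fun f => ⟨f.1.1, f.1.2.1, f.2⟩
      left_inv := fun f => rfl
      right_inv := fun f => rfl }

theorem planePartitionCount_zero : planePartitionCount 0 = 1 := by
  simp [planePartitionCount_eq_coeff (le_refl 0)]

namespace PowerSeries

/-- The product of `X` and the logarithmic derivative of `geomSeries d`. -/
def geomLogDeriv (d : ℕ) : ℚ⟦X⟧ := mk fun n => if 0 < n ∧ d ∣ n then (d : ℚ) else 0

theorem X_mul_derivative_geomSeries {d : ℕ} (hd : 0 < d) :
    X * d⁄dX ℚ ((geomSeries d).map (Nat.castRingHom ℚ)) =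
      (geomSeries d).map (Nat.castRingHom ℚ) * geomLogDeriv d := by
  set G := (geomSeries d).map (Nat.castRingHom ℚ) with hG
  have hcoeff (n : ℕ) : coeff n G = if d ∣ n then 1 else 0 := by
    simp [hG, geomSeries]
  have hdvd {n : ℕ} (hn : d ≤ n) : d ∣ n - d ↔ d ∣ n :=
    (Nat.dvd_sub_iff_left hn (dvd_refl d))
  have hL : geomLogDeriv d = C (d : ℚ) * (X ^ d * G) := by
    ext n
    rw [coeff_C_mul, coeff_X_pow_mul', geomLogDeriv, coeff_mk]
    by_cases hn : d ≤ n
    · simp [hn, hcoeff, hd.trans_le hn, hdvd hn]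
    · have : ¬ (0 < n ∧ d ∣ n) := fun h => hn (Nat.le_of_dvd h.1 h.2)
      simp [hn, this]
  have hinv : G * (1 - X ^ d) = 1 := by
    ext n
    rw [mul_sub, mul_one, map_sub, coeff_mul_X_pow', hcoeff, hcoeff, coeff_one]
    by_cases hn : d ≤ n
    · have : n ≠ 0 := by omega
      simp [hn, this, hdvd hn]
    · by_cases h0 : n = 0
      · simp [h0, hd.ne']
      · have : ¬ d ∣ n := fun h => hn (Nat.le_of_dvd (Nat.pos_of_ne_zero h0) h)
        simp [hn, h0, this]
  have hder := congrArg (d⁄dX ℚ) hinv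
  rw [Derivation.leibniz, map_sub, derivative_one, derivative_pow, derivative_X] at hder
  simp only [smul_eq_mul] at hder
  have hX : (X : ℚ⟦X⟧) ^ d = X * X ^ (d - 1) := by
    rw [← pow_succ', Nat.sub_add_cancel hd]
  rw [hL, map_natCast]
  linear_combination (X * G) * hder - (X * d⁄dX ℚ G) * hinv - G ^ 2 * (d : ℚ⟦X⟧) * hX

theorem X_mul_derivative_prod {ι : Type*} (s : Finset ι) (G L : ι → ℚ⟦X⟧)
    (h : ∀ i ∈ s, X * d⁄dX ℚ (G i) = G i * L i) :
    X * d⁄dX ℚ (∏ i ∈ s, G i) = (∏ i ∈ s, G i) * ∑ i ∈ s, L i := by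
  classical
  induction s using Finset.induction_on with
  | empty => simp
  | insert i s hi ih =>
    rw [Finset.prod_insert hi, Finset.sum_insert hi, Derivation.leibniz]
    have h1 := h i (Finset.mem_insert_self i s)
    have h2 := ih fun j hj => h j (Finset.mem_insert_of_mem hj)
    simp only [smul_eq_mul]
    linear_combination (∏ i ∈ s, G i) * h1 + G i * h2

end PowerSeries

theorem sum_range_product_ite_dvd {n k : ℕ} (hk : k ≤ n) :
    ∑ x ∈ Finset.range n ×ˢ Finset.range n,
      (if 0 < k ∧ x.1 + x.2 + 1 ∣ k then ((x.1 + x.2 + 1 : ℕ) : ℚ) else 0) =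
        ∑ d ∈ k.divisors, (d : ℚ) ^ 2 := by
  rw [← Finset.sum_filter, ← Finset.sum_fiberwise_of_maps_to (t := k.divisors)
    (g := fun x : ℕ × ℕ => x.1 + x.2 + 1)]
  · refine Finset.sum_congr rfl fun d hd => ?_
    have hdk := Nat.dvd_of_mem_divisors hd
    have hd0 := Nat.pos_of_mem_divisors hd
    have hk0 : 0 < k := Nat.pos_of_ne_zero (Nat.mem_divisors.mp hd).2
    have hle := Nat.le_of_dvd hk0 hdk
    have hset : ((Finset.range n ×ˢ Finset.range n).filter
        fun x : ℕ × ℕ => 0 < k ∧ x.1 + x.2 + 1 ∣ k).filter (fun x => x.1 + x.2 + 1 = d) =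
        Finset.HasAntidiagonal.antidiagonal (d - 1) := by
      ext x
      simp only [Finset.mem_filter, Finset.mem_product, Finset.mem_range,
        Finset.HasAntidiagonal.mem_antidiagonal]
      constructor
      · rintro ⟨-, h⟩
        omega
      · intro h
        have : x.1 + x.2 + 1 = d := by omega
        exact ⟨⟨⟨by omega, by omega⟩, hk0, this ▸ hdk⟩, this⟩
    rw [hset, Finset.sum_congr rfl (g := fun _ => (d : ℚ)), Finset.sum_const,
      Finset.Nat.card_antidiagonal, Nat.sub_add_cancel hd0, nsmul_eq_mul, sq]
    intro x hx
    have := Finset.HasAntidiagonal.mem_antidiagonal.mp hx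
    congr 1
    omega
  · intro x hx
    obtain ⟨-, h1, h2⟩ := Finset.mem_filter.mp hx
    exact Nat.mem_divisors.mpr ⟨h2, h1.ne'⟩

open PowerSeries in
/-- The recursion for the number of plane partitions. -/
theorem nat_mul_planePartitionCount (n : ℕ) :
    (n : ℚ) * planePartitionCount n =
      ∑ i ∈ Finset.range (n + 1),
        (planePartitionCount i : ℚ) * ∑ d ∈ (n - i).divisors, (d : ℚ) ^ 2 := by
  have h := X_mul_derivative_prod (Finset.range n ×ˢ Finset.range n)
    (fun x => (geomSeries (x.1 + x.2 + 1)).map (Nat.castRingHom ℚ))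
    (fun x => geomLogDeriv (x.1 + x.2 + 1))
    fun x _ => X_mul_derivative_geomSeries (Nat.succ_pos _)
  rw [← map_prod] at h
  have hP {k : ℕ} (hk : k ≤ n) : coeff k (PowerSeries.map (Nat.castRingHom ℚ)
      (∏ x ∈ Finset.range n ×ˢ Finset.range n, geomSeries (x.1 + x.2 + 1))) =
        (planePartitionCount k : ℚ) := by
    rw [coeff_map, ← planePartitionCount_eq_coeff hk]
    rfl
  have hn := congrArg (coeff n) h
  have hleft : coeff n (X * d⁄dX ℚ (PowerSeries.map (Nat.castRingHom ℚ)
      (∏ x ∈ Finset.range n ×ˢ Finset.range n, geomSeries (x.1 + x.2 + 1)))) =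
        (n : ℚ) * planePartitionCount n := by
    rw [← hP le_rfl]
    cases n with
    | zero => simp
    | succ m =>
      rw [coeff_succ_X_mul, coeff_derivative]
      push_cast
      ring
  rw [hleft, coeff_mul, Finset.Nat.sum_antidiagonal_eq_sum_range_succ_mk] at hn
  rw [hn]
  refine Finset.sum_congr rfl fun i hi => ?_
  rw [hP (Nat.lt_succ_iff.mp (Finset.mem_range.mp hi)),
    ← sum_range_product_ite_dvd (Nat.sub_le n i), map_sum]
  simp only [geomLogDeriv, coeff_mk]

theorem Nat.Partition.ne_indiscrete_iff {n : ℕ} (hn : 0 < n) (α : Nat.Partition n) :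
    α ≠ Nat.Partition.indiscrete n ↔ 1 < α.parts.card := by
  have hpos : 0 < α.parts.card := by
    rw [Multiset.card_pos]
    intro h
    have := α.parts_sum
    simp [h] at this
    omega
  rw [← not_iff_not, not_not, not_lt]
  constructor
  · rintro rfl
    simp [Nat.Partition.indiscrete_parts hn.ne']
  · intro h
    obtain ⟨a, ha⟩ := Multiset.card_eq_one.mp (le_antisymm h hpos)
    have hsum := α.parts_sum
    rw [ha, Multiset.sum_singleton] at hsum
    ext1
    rw [Nat.Partition.indiscrete_parts hn.ne', ha, hsum]

/-- The partition of `n` obtained from a partition of `n - i` by adding one part `i`. -/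
def Nat.Partition.consPart {n i : ℕ} (hi : 0 < i) (hin : i ≤ n) (β : Nat.Partition (n - i)) :
    Nat.Partition n where
  parts := i ::ₘ β.parts
  parts_pos := fun hj => by
    rcases Multiset.mem_cons.mp hj with rfl | hj
    · exact hi
    · exact β.parts_pos hj
  parts_sum := by
    rw [Multiset.sum_cons, β.parts_sum]
    omega

theorem Nat.Partition.one_lt_card_consPart {n i : ℕ} (hi : 0 < i) (hin : i < n)
    (β : Nat.Partition (n - i)) : 1 < (β.consPart hi hin.le).parts.card := by
  have : 0 < β.parts.card := by
    rw [Multiset.card_pos]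
    intro h
    have := β.parts_sum
    simp [h] at this
    omega
  simpa [Nat.Partition.consPart] using this

/-- Summing over partitions of `n` with more than one part and their distinct part sizes amounts
to summing over a part size `i < n` and a partition of `n - i`. -/
theorem Nat.Partition.sum_attach_toFinset {M : Type*} [AddCommMonoid M] {n : ℕ} (hn : 0 < n)
    (F : (i : ℕ) → Nat.Partition (n - i) → M) :
    ∑ α ∈ Finset.univ.erase (Nat.Partition.indiscrete n), ∑ i ∈ α.parts.toFinset.attach,
      F i (α.erasePart (Multiset.mem_toFinset.mp i.2)) =
        ∑ i ∈ Finset.Ico 1 n, ∑ β, F i β := by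
  rw [Finset.sum_sigma', Finset.sum_sigma']
  have hmem (β : (i : ℕ) × Nat.Partition (n - i))
      (h : β ∈ (Finset.Ico 1 n).sigma fun i => (Finset.univ : Finset (Nat.Partition (n - i)))) :
      0 < β.1 ∧ β.1 < n := by
    simpa [Nat.one_le_iff_ne_zero, Nat.pos_iff_ne_zero] using h
  refine Finset.sum_bij'
    (fun x _ => ⟨x.2.1, x.1.erasePart (Multiset.mem_toFinset.mp x.2.2)⟩)
    (fun x hx => ⟨x.2.consPart (hmem x hx).1 (hmem x hx).2.le,
      ⟨x.1, Multiset.mem_toFinset.mpr (Multiset.mem_cons_self _ _)⟩⟩) ?_ ?_ ?_ ?_ ?_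
  · rintro ⟨α, i, hi⟩ hx
    have hα := (α.ne_indiscrete_iff hn).mp
      (Finset.ne_of_mem_erase (Finset.mem_sigma.mp hx).1)
    have hi' := Multiset.mem_toFinset.mp hi
    simpa using ⟨α.parts_pos hi', α.part_lt_of_one_lt_card hα hi'⟩
  · intro x hx
    refine Finset.mem_sigma.mpr ⟨Finset.mem_erase.mpr ⟨?_, Finset.mem_univ _⟩,
      Finset.mem_attach _ _⟩
    exact (Nat.Partition.ne_indiscrete_iff hn _).mpr
      (x.2.one_lt_card_consPart (hmem x hx).1 (hmem x hx).2)
  · rintro ⟨α, i, hi⟩ hx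
    exact Sigma.subtype_ext
      (Nat.Partition.ext (Multiset.cons_erase (Multiset.mem_toFinset.mp hi))) rfl
  · rintro ⟨i, β⟩ hx
    exact Sigma.ext rfl (heq_of_eq (Nat.Partition.ext (Multiset.erase_cons_head _ _)))
  · intro x hx
    rfl

theorem Nat.Partition.prod_pow_count {M : Type*} [CommMonoid M] {n : ℕ} (α : Nat.Partition n)
    (p : ℕ → M) : ∏ i ∈ Finset.Icc 1 n, p i ^ α.parts.count i = (α.parts.map p).prod := by
  rw [Finset.prod_multiset_map_count]
  refine (Finset.prod_subset (fun i hi => ?_) fun i _ hi => ?_).symm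
  · have hi' := Multiset.mem_toFinset.mp hi
    have hle := Multiset.single_le_sum (fun x _ => Nat.zero_le x) i hi'
    rw [α.parts_sum] at hle
    exact Finset.mem_Icc.mpr ⟨α.parts_pos hi', hle⟩
  · rw [Multiset.count_eq_zero_of_notMem fun h => hi (Multiset.mem_toFinset.mpr h), pow_zero]

theorem Nat.Partition.prod_map_erasePart {M : Type*} [CommMonoid M] {n : ℕ} (α : Nat.Partition n)
    (p : ℕ → M) {i : ℕ} (hi : i ∈ α.parts) :
    (α.parts.map p).prod = p i * ((α.erasePart hi).parts.map p).prod := by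
  conv_lhs => rw [← Multiset.cons_erase hi, Multiset.map_cons, Multiset.prod_cons]
  rfl

/-- The generating sum of `e` over the partitions of `n`, with weight `p i` for each part `i`. -/
noncomputable def kummerSum (e : (n : ℕ+) → Nat.Partition (n : ℕ) → ℚ) (p : ℕ → ℚ) (n : ℕ) : ℚ :=
  if hn : 0 < n then ∑ α : Nat.Partition n, e ⟨n, hn⟩ α * (α.parts.map p).prod else 0

theorem IsKummerE.kummerSum_eq {e : (n : ℕ+) → Nat.Partition (n : ℕ) → ℚ} (he : IsKummerE e)
    (p : ℕ → ℚ) {n : ℕ} (hn : 0 < n) :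
    kummerSum e p n = (n : ℚ) ^ 2 * p n -
      ∑ i ∈ Finset.Ico 1 n, (n : ℚ) / ((n : ℚ) - i) * p i * kummerSum e p (n - i) := by
  rw [kummerSum, dif_pos hn, ← Finset.add_sum_erase _ _ (Finset.mem_univ
    (Nat.Partition.indiscrete n)), sub_eq_add_neg, ← Finset.sum_neg_distrib]
  congr 1
  · have h1 := he.1 ⟨n, hn⟩
    simp only [PNat.mk_coe] at h1
    rw [h1, Nat.Partition.indiscrete_parts hn.ne', Multiset.map_singleton,
      Multiset.prod_singleton]
  · let F (i : ℕ) (β : Nat.Partition (n - i)) : ℚ :=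
      -((n : ℚ) / ((n : ℚ) - i) * p i *
        if h : 0 < n - i then e ⟨n - i, h⟩ β * (β.parts.map p).prod else 0)
    trans ∑ i ∈ Finset.Ico 1 n, ∑ β, F i β
    · rw [← Nat.Partition.sum_attach_toFinset hn]
      refine Finset.sum_congr rfl fun α hα => ?_
      have hcard := (α.ne_indiscrete_iff hn).mp (Finset.ne_of_mem_erase hα)
      rw [he.2 ⟨n, hn⟩ α hcard, neg_mul, Finset.sum_mul, ← Finset.sum_neg_distrib]
      refine Finset.sum_congr rfl fun i _ => ?_
      have hi := Multiset.mem_toFinset.mp i.2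
      have hlt : 0 < n - (i : ℕ) := Nat.sub_pos_of_lt (α.part_lt_of_one_lt_card hcard hi)
      rw [α.prod_map_erasePart p hi]
      simp only [F, dif_pos hlt, PNat.mk_coe]
      ring
    · refine Finset.sum_congr rfl fun i hi => ?_
      have hlt : 0 < n - i := Nat.sub_pos_of_lt (Finset.mem_Ico.mp hi).2
      simp only [F, kummerSum, dif_pos hlt, Finset.sum_neg_distrib, Finset.mul_sum]

theorem IsKummerE.kummerSum_planePartitionCount
    {e : (n : ℕ+) → Nat.Partition (n : ℕ) → ℚ} (he : IsKummerE e) {n : ℕ} (hn : 0 < n) :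
    kummerSum e (fun i => (planePartitionCount i : ℚ)) n =
      (n : ℚ) * ∑ d ∈ n.divisors, (d : ℚ) ^ 2 := by
  induction n using Nat.strong_induction_on with
  | _ n ih =>
    have hrec := nat_mul_planePartitionCount n
    rw [Finset.sum_range_succ, Nat.sub_self, Nat.divisors_zero, Finset.sum_empty, mul_zero,
      add_zero, Finset.range_eq_Ico, Finset.sum_eq_sum_Ico_succ_bot hn, planePartitionCount_zero,
      Nat.cast_one, one_mul, Nat.sub_zero] at hrec
    have hsum : ∑ i ∈ Finset.Ico 1 n, (n : ℚ) / ((n : ℚ) - i) * (planePartitionCount i : ℚ) *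
        kummerSum e (fun i => (planePartitionCount i : ℚ)) (n - i) =
          n * ∑ i ∈ Finset.Ico 1 n,
            (planePartitionCount i : ℚ) * ∑ d ∈ (n - i).divisors, (d : ℚ) ^ 2 := by
      rw [Finset.mul_sum]
      refine Finset.sum_congr rfl fun i hi => ?_
      obtain ⟨h1, h2⟩ := Finset.mem_Ico.mp hi
      have hne : (n : ℚ) - i ≠ 0 := sub_ne_zero.mpr (by exact_mod_cast h2.ne')
      rw [ih (n - i) (by omega) (by omega), Nat.cast_sub h2.le]
      field_simp
    rw [he.kummerSum_eq _ hn, hsum]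
    rw [zero_add] at hrec
    linear_combination (n : ℚ) * hrec

/-- The combinatorial formula
`n ∑_{d ∣ n} d ^ 2 = ∑_α e(α) P₃(1)^{α_1} ⋯ P₃(n)^{α_n}`, where `α` runs over
all partitions of `n` and `P₃(i)` is the number of plane partitions of `i`. -/
theorem sigma_two_eq_sum_kummerE
    (e : (n : ℕ+) → Nat.Partition (n : ℕ) → ℚ) (he : IsKummerE e) :
    ∀ (n : ℕ) (hn : 0 < n),
      (n : ℚ) * ∑ d ∈ n.divisors, (d : ℚ) ^ 2 =
        ∑ α : Nat.Partition n, e ⟨n, hn⟩ α *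
          ∏ i ∈ Finset.Icc 1 n,
            (planePartitionCount i : ℚ) ^ α.parts.count i := by
  intro n hn
  rw [← he.kummerSum_planePartitionCount hn, kummerSum, dif_pos hn]
  exact Finset.sum_congr rfl fun α _ => by rw [α.prod_pow_count]
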